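/- Let k ≥ 0, ℓ ≥ 1, λ ∈ P_ℓ^k, z an integer with 1 ≤ z ≤ bot_λ − 1, and a ≥ 1 an integer such that d := down_λ^a(z) ∈ [1, bot_λ] (so down_λ^{a+1}(z) is defined). Suppose γ := λ − ε_d ∉ P_ℓ^k and λ_z > λ_{z+1}. Then K(Δ^k(λ); M_z(λ); λ − ε_d) = K(Δ^k(λ); M_z(λ); λ − ε_{down_λ^{a+1}(z)}). -/

import Mathlib

open scoped Classical

noncomputable section

/-- The ambient ring: formal power series over ℚ in countably many variables. -/
abbrev R : Type := MvPowerSeries ℕ ℚ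

/-- The complete homogeneous symmetric function `h_m` (equal to `0` for `m < 0`):
its coefficient at a monomial is `1` if the monomial has total degree `m`, else `0`. -/
def hh (m : ℤ) : R := fun d => if ((d.sum fun _ e => (e : ℤ)) = m) then 1 else 0

/-- The inhomogeneous analogue `k_m^{(r)} = ∑_{i=0}^{m} C(r+i−1, i) · h_{m−i}`. -/
def kk (r : ℕ) (m : ℤ) : R :=
  ∑ i ∈ Finset.range (m.toNat + 1), ((r + i - 1).choose i : ℚ) • hh (m - (i : ℤ))

/-- The dual stable Grothendieck polynomial `g_γ`, as an `ℓ × ℓ` determinant with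
`(i,j)` entry `k_{γ_i + j − i}^{(i−1)}` (indices 1-based). -/
def gg (ℓ : ℕ) (γ : ℕ → ℤ) : R :=
  (Matrix.of fun i j : Fin ℓ =>
    kk i.val (γ (i.val + 1) + (j.val : ℤ) - (i.val : ℤ))).det

/-- The `i`-th standard basis vector `ε_i`. -/
def eps (i : ℕ) : ℕ → ℤ := fun x => if x = i then 1 else 0

/-- The Katalan function `K(Ψ; M; γ)`. -/
def katalan (ℓ : ℕ) (Ψ : Finset (ℕ × ℕ)) (M : Multiset ℕ) (γ : ℕ → ℤ) : R :=
  (M.powerset.map fun S =>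
    (-1 : R) ^ Multiset.card S *
      ∑ᶠ α : {p // p ∈ Ψ} → ℕ,
        gg ℓ (fun x =>
          γ x + (∑ p ∈ Ψ.attach, (α p : ℤ) * (eps p.1.1 x - eps p.1.2 x))
            - (S.map fun z => eps z x).sum)).sum

/-- The set of positive roots `Δ_ℓ^+ = {(i,j) : 1 ≤ i < j ≤ ℓ}`. -/
def DeltaPlus (ℓ : ℕ) : Finset (ℕ × ℕ) :=
  (Finset.Icc 1 ℓ ×ˢ Finset.Icc 1 ℓ).filter fun p => p.1 < p.2

/-- A root ideal: an upper order ideal of `Δ_ℓ^+`. -/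
def IsRootIdeal (ℓ : ℕ) (Ψ : Finset (ℕ × ℕ)) : Prop :=
  Ψ ⊆ DeltaPlus ℓ ∧
    ∀ a b c d : ℕ, (a, b) ∈ Ψ → (c, d) ∈ DeltaPlus ℓ → c ≤ a → b ≤ d → (c, d) ∈ Ψ

/-- The root ideal `Δ^k(λ) = {(i,j) ∈ Δ_ℓ^+ : j > k − λ_i + i}`. -/
def DeltaK (k ℓ : ℕ) (lam : ℕ → ℤ) : Finset (ℕ × ℕ) :=
  (DeltaPlus ℓ).filter fun p => (k : ℤ) - lam p.1 + (p.1 : ℤ) < (p.2 : ℤ)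

/-- `bot(Ψ)`: the largest `x` such that row `x` of `Ψ` is nonempty (`0` if `Ψ = ∅`). -/
def botIdeal (Ψ : Finset (ℕ × ℕ)) : ℕ := Ψ.sup Prod.fst

/-- `bot_λ := bot(Δ^k(λ))`. -/
def botL (k ℓ : ℕ) (lam : ℕ → ℤ) : ℕ := botIdeal (DeltaK k ℓ lam)

/-- A removable root of a root ideal. -/
def IsRemovable (ℓ : ℕ) (Ψ : Finset (ℕ × ℕ)) (α : ℕ × ℕ) : Prop :=
  α ∈ Ψ ∧ IsRootIdeal ℓ (Ψ.erase α)

/-- `down_Ψ(x)` is defined, i.e. row `x` of `Ψ` contains a removable root. -/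
def HasDown (ℓ : ℕ) (Ψ : Finset (ℕ × ℕ)) (x : ℕ) : Prop :=
  ∃ j, IsRemovable ℓ Ψ (x, j)

/-- `down_Ψ(x)`: the column of the removable root in row `x` (junk value `0` if
row `x` has no removable root). -/
def down (ℓ : ℕ) (Ψ : Finset (ℕ × ℕ)) (x : ℕ) : ℕ :=
  ((Ψ.filter fun p => p.1 = x ∧ IsRemovable ℓ Ψ p).image Prod.snd).sup id

/-- `down_λ := down_{Δ^k(λ)}`. -/
def downL (k ℓ : ℕ) (lam : ℕ → ℤ) : ℕ → ℕ := down ℓ (DeltaK k ℓ lam)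

/-- The `a`-fold iterate `down_Ψ^a(x)` is defined. -/
def DownIterDefined (ℓ : ℕ) (Ψ : Finset (ℕ × ℕ)) (a x : ℕ) : Prop :=
  ∀ b < a, HasDown ℓ Ψ ((down ℓ Ψ)^[b] x)

/-- `L(ℛ)`: the multiset of second components of `ℛ`, with multiplicity. -/
def Lmul (ℛ : Finset (ℕ × ℕ)) : Multiset ℕ := ℛ.val.map Prod.snd

/-- `λ ∈ P_ℓ^k`: a `k`-bounded partition with `ℓ` parts allowed to be zero. -/
def IsKBounded (k ℓ : ℕ) (lam : ℕ → ℤ) : Prop :=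
  lam 1 ≤ (k : ℤ) ∧ (∀ i, 1 ≤ i → i < ℓ → lam (i + 1) ≤ lam i) ∧ 0 ≤ lam ℓ

/-- The multiset `M_z(λ)`: `L(Δ^k(λ))` with one occurrence of `down_λ(x)` removed
for each `x ∈ [z, bot_λ]`. -/
def Mz (k ℓ : ℕ) (lam : ℕ → ℤ) (z : ℕ) : Multiset ℕ :=
  Lmul (DeltaK k ℓ lam) - ((Finset.Icc z (botL k ℓ lam)).val.map (downL k ℓ lam))

/-- The `K`-`k`-Schur function of weight `z`: `ĝ_λ^{(z)} = K(Δ^k(λ); M_z(λ); λ)`. -/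
def wkschur (k ℓ : ℕ) (lam : ℕ → ℤ) (z : ℕ) : R :=
  katalan ℓ (DeltaK k ℓ lam) (Mz k ℓ lam z) lam

/-- The `K`-`k`-Schur function `g_λ^{(k)} = K(Δ^k(λ); L(Δ^{k+1}(λ)); λ)`. -/
def kkschur (k ℓ : ℕ) (lam : ℕ → ℤ) : R :=
  katalan ℓ (DeltaK k ℓ lam) (Lmul (DeltaK (k + 1) ℓ lam)) lam

/-- The closed `k`-Schur Katalan function `𝔤_λ^{(k)} = K(Δ^k(λ); L(Δ^k(λ)); λ)`. -/
def closedkschur (k ℓ : ℕ) (lam : ℕ → ℤ) : R :=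
  katalan ℓ (DeltaK k ℓ lam) (Lmul (DeltaK k ℓ lam)) lam

/-- `|λ| = λ_1 + ⋯ + λ_ℓ`. -/
def psize (ℓ : ℕ) (lam : ℕ → ℤ) : ℤ := ∑ i ∈ Finset.Icc 1 ℓ, lam i

theorem hh_of_neg {m : ℤ} (hm : m < 0) : hh m = 0 := by
  funext d
  have h : (0 : ℤ) ≤ d.sum fun _ e => (e : ℤ) := Finset.sum_nonneg fun _ _ => by positivity
  simp only [hh]
  rw [if_neg (by omega)]
  rfl

theorem kk_of_neg (r : ℕ) {m : ℤ} (hm : m < 0) : kk r m = 0 :=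
  Finset.sum_eq_zero fun i _ => by rw [hh_of_neg (by omega), smul_zero]

theorem kk_sub_kk (r : ℕ) (m : ℤ) : kk (r + 1) m - kk (r + 1) (m - 1) = kk r m := by
  rcases lt_trichotomy m 0 with hm | rfl | hm
  · simp [kk_of_neg, hm, show m - 1 < 0 by omega]
  · rw [kk_of_neg (r + 1) (by omega : (0 : ℤ) - 1 < 0)]
    simp [kk]
  · obtain ⟨n, rfl⟩ : ∃ n : ℕ, m = n + 1 := ⟨(m - 1).toNat, by omega⟩
    have h1 : ((n : ℤ) + 1).toNat = n + 1 := by omega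
    have h2 : ((n : ℤ) + 1 - 1).toNat = n := by omega
    unfold kk
    rw [h1, h2, Finset.sum_range_succ' _ (n + 1), Finset.sum_range_succ' _ (n + 1),
      add_sub_right_comm, ← Finset.sum_sub_distrib]
    congr 1
    · refine Finset.sum_congr rfl fun i _ => ?_
      have e : (n : ℤ) + 1 - 1 - (i : ℤ) = n + 1 - ((i + 1 : ℕ) : ℤ) := by push_cast; ring
      rw [e, ← sub_smul]
      congr 1
      have h3 : r + 1 + (i + 1) - 1 = (r + i) + 1 := by omega
      have h4 : r + 1 + i - 1 = r + i := by omega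
      have h5 : r + (i + 1) - 1 = r + i := by omega
      rw [h3, h4, h5, Nat.choose_succ_succ]
      push_cast
      ring
    · simp

/-- The dot action of the simple transposition exchanging `y` and `y + 1`. -/
def dotSwap (y : ℕ) (γ : ℕ → ℤ) : ℕ → ℤ := fun x =>
  γ (Equiv.swap y (y + 1) x) - eps y x + eps (y + 1) x

theorem gg_sub_eps_eq_det {ℓ y : ℕ} (hy : y + 1 < ℓ) (γ : ℕ → ℤ) :
    gg ℓ γ - gg ℓ (fun x => γ x - eps (y + 2) x) =
      (Matrix.of fun i j : Fin ℓ =>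
        kk (if i.val = y + 1 then y else i.val)
          (γ (i.val + 1) + (j.val : ℤ) - (i.val : ℤ))).det := by
  set r : Fin ℓ := ⟨y + 1, hy⟩
  set A : Matrix (Fin ℓ) (Fin ℓ) R := Matrix.of fun i j : Fin ℓ =>
    kk i.val (γ (i.val + 1) + (j.val : ℤ) - (i.val : ℤ)) with hA
  have hB : (Matrix.of fun i j : Fin ℓ => kk i.val
      (γ (i.val + 1) - eps (y + 2) (i.val + 1) + (j.val : ℤ) - (i.val : ℤ))) =
      A.updateRow r (fun j => kk (y + 1) (γ (y + 2) + (j.val : ℤ) - (y + 1 : ℕ) - 1)) := by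
    ext1 i j
    by_cases h : i = r
    · subst h
      simp only [Matrix.updateRow_self, Matrix.of_apply, eps, r]
      congr 1
      simp
      ring
    · have : i.val ≠ y + 1 := fun h' => h (Fin.ext h')
      simp [Matrix.updateRow_ne h, hA, eps, this]
  have hC : (Matrix.of fun i j : Fin ℓ =>
        kk (if i.val = y + 1 then y else i.val)
          (γ (i.val + 1) + (j.val : ℤ) - (i.val : ℤ))) =
      A.updateRow r (fun j => kk y (γ (y + 2) + (j.val : ℤ) - (y + 1 : ℕ))) := by
    ext1 i j
    by_cases h : i = r
    · subst h
      simp [Matrix.updateRow_self, r]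
    · have : i.val ≠ y + 1 := fun h' => h (Fin.ext h')
      simp [Matrix.updateRow_ne h, hA, this]
  have hA' : A = A.updateRow r (fun j => kk (y + 1) (γ (y + 2) + (j.val : ℤ) - (y + 1 : ℕ))) := by
    ext1 i j
    by_cases h : i = r
    · subst h
      simp [Matrix.updateRow_self, hA, r]
    · simp [Matrix.updateRow_ne h]
  unfold gg
  rw [hB, hC, ← hA, sub_eq_iff_eq_add]
  conv_lhs => rw [hA']
  rw [← Matrix.det_updateRow_add]
  congr 2
  funext j
  simp [← kk_sub_kk y]

theorem gg_dotSwap {ℓ y : ℕ} (hy : 1 ≤ y) (hyℓ : y < ℓ) (γ : ℕ → ℤ) :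
    gg ℓ (dotSwap y γ) - gg ℓ (fun x => dotSwap y γ x - eps (y + 1) x) =
      -(gg ℓ γ - gg ℓ (fun x => γ x - eps (y + 1) x)) := by
  obtain ⟨y, rfl⟩ : ∃ t, y = t + 1 := ⟨y - 1, by omega⟩
  rw [gg_sub_eps_eq_det hyℓ, gg_sub_eps_eq_det hyℓ]
  set p : Fin ℓ := ⟨y, by omega⟩ with hp
  set q : Fin ℓ := ⟨y + 1, hyℓ⟩ with hq
  have hpq : p ≠ q := by simp [hp, hq]
  have key := Matrix.det_permute (Equiv.swap p q) (Matrix.of fun i j : Fin ℓ =>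
        kk (if i.val = y + 1 then y else i.val)
          (γ (i.val + 1) + (j.val : ℤ) - (i.val : ℤ)))
  rw [Equiv.Perm.sign_swap hpq] at key
  simp only [Units.val_neg, Units.val_one, Int.cast_neg, Int.cast_one, neg_mul, one_mul] at key
  rw [← key]
  congr 1
  ext1 i j
  by_cases h1 : i = p
  · subst h1
    simp [dotSwap, eps, hp, hq]
    congr 1
    ring
  · by_cases h2 : i = q
    · subst h2
      simp [dotSwap, eps, hp, hq]
      congr 1
      ring
    · have h1' : i.val ≠ y := fun h => h1 (Fin.ext h)
      have h2' : i.val ≠ y + 1 := fun h => h2 (Fin.ext h)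
      have h3 : Equiv.swap (y + 1) (y + 1 + 1) (i.val + 1) = i.val + 1 :=
        Equiv.swap_apply_of_ne_of_ne (by omega) (by omega)
      simp [dotSwap, eps, h3, h1', h2', Equiv.swap_apply_of_ne_of_ne h1 h2]

theorem gg_eq_zero {ℓ i : ℕ} {γ : ℕ → ℤ} (hi : i ∈ Finset.Icc 1 ℓ) (h : γ i < -ℓ) :
    gg ℓ γ = 0 := by
  obtain ⟨h1, h2⟩ := Finset.mem_Icc.1 hi
  refine Matrix.det_eq_zero_of_row_eq_zero (⟨i - 1, by omega⟩ : Fin ℓ) fun j => ?_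
  simp only [Matrix.of_apply, Nat.sub_add_cancel h1]
  exact kk_of_neg _ (by have := j.isLt; omega)

/-- The weight `γ + ∑_{p ∈ Φ} α(p) ε_p`, where `ε_{(i,j)} = ε_i - ε_j`. -/
def rootWeight (Φ : Finset (ℕ × ℕ)) (γ : ℕ → ℤ) (α : {p // p ∈ Φ} → ℕ) : ℕ → ℤ := fun x =>
  γ x + ∑ p ∈ Φ.attach, (α p : ℤ) * (eps p.1.1 x - eps p.1.2 x)

theorem katalan_zero (ℓ : ℕ) (Φ : Finset (ℕ × ℕ)) (γ : ℕ → ℤ) :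
    katalan ℓ Φ 0 γ = ∑ᶠ α, gg ℓ (rootWeight Φ γ α) := by
  simp only [katalan, Multiset.powerset_zero, Multiset.map_singleton, Multiset.sum_singleton,
    Multiset.card_zero, pow_zero, one_mul, Multiset.map_zero, Multiset.sum_zero, sub_zero]
  rfl

theorem katalan_cons (ℓ : ℕ) (Φ : Finset (ℕ × ℕ)) (m : ℕ) (M : Multiset ℕ) (γ : ℕ → ℤ) :
    katalan ℓ Φ (m ::ₘ M) γ = katalan ℓ Φ M γ - katalan ℓ Φ M (γ - eps m) := by
  unfold katalan
  rw [Multiset.powerset_cons, Multiset.map_add, Multiset.sum_add, Multiset.map_map, sub_eq_add_neg,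
    ← Multiset.sum_map_neg', Multiset.map_map]
  congr 1
  refine congrArg _ (Multiset.map_congr rfl fun S _ => ?_)
  simp only [Function.comp, Multiset.card_cons, Multiset.map_cons, Multiset.sum_cons, pow_succ,
    mul_neg, mul_one, neg_mul, Pi.sub_apply]
  congr! 6
  ring

theorem sum_Icc_eps (t n i : ℕ) :
    ∑ x ∈ Finset.Icc t n, eps i x = if i ∈ Finset.Icc t n then 1 else 0 := by
  simp [eps]

theorem le_of_gg_ne_zero {ℓ : ℕ} {Φ : Finset (ℕ × ℕ)} (hΦ : Φ ⊆ DeltaPlus ℓ) {γ : ℕ → ℤ}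
    {α : {p // p ∈ Φ} → ℕ} (h : gg ℓ (rootWeight Φ γ α) ≠ 0) (p : {p // p ∈ Φ}) :
    (α p : ℤ) ≤ ∑ x ∈ Finset.Icc p.1.2 ℓ, (γ x + ℓ) := by
  have hmem : ∀ q : {p // p ∈ Φ}, 1 ≤ q.1.1 ∧ q.1.1 < q.1.2 ∧ q.1.2 ≤ ℓ := fun q => by
    have := hΦ q.2
    simp only [DeltaPlus, Finset.mem_filter, Finset.mem_product, Finset.mem_Icc] at this
    omega
  have hw : ∀ x ∈ Finset.Icc p.1.2 ℓ, 0 ≤ rootWeight Φ γ α x + ℓ := fun x hx => by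
    by_contra hlt
    have hp := hmem p
    rw [Finset.mem_Icc] at hx
    exact h (gg_eq_zero (i := x) (Finset.mem_Icc.2 (by omega)) (by omega))
  have hs := Finset.sum_nonneg hw
  have e : ∑ x ∈ Finset.Icc p.1.2 ℓ, (rootWeight Φ γ α x + ℓ) =
      ∑ x ∈ Finset.Icc p.1.2 ℓ, (γ x + ℓ) + ∑ q ∈ Φ.attach, (α q : ℤ) *
        (∑ x ∈ Finset.Icc p.1.2 ℓ, eps q.1.1 x - ∑ x ∈ Finset.Icc p.1.2 ℓ, eps q.1.2 x) := by
    simp only [← Finset.sum_sub_distrib, Finset.mul_sum]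
    rw [Finset.sum_comm, ← Finset.sum_add_distrib]
    refine Finset.sum_congr rfl fun x _ => ?_
    simp only [rootWeight]
    ring
  rw [e] at hs
  have hle : ∑ q ∈ Φ.attach, (α q : ℤ) *
      (∑ x ∈ Finset.Icc p.1.2 ℓ, eps q.1.1 x - ∑ x ∈ Finset.Icc p.1.2 ℓ, eps q.1.2 x) ≤ -α p := by
    rw [← Finset.add_sum_erase _ _ (Finset.mem_attach Φ p)]
    have h0 : ∑ q ∈ Φ.attach.erase p, (α q : ℤ) *
      (∑ x ∈ Finset.Icc p.1.2 ℓ, eps q.1.1 x - ∑ x ∈ Finset.Icc p.1.2 ℓ, eps q.1.2 x) ≤ 0 := by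
      refine Finset.sum_nonpos fun q _ => mul_nonpos_of_nonneg_of_nonpos (by positivity) ?_
      have hq := hmem q
      simp only [sum_Icc_eps, Finset.mem_Icc]
      split_ifs <;> omega
    have hp := hmem p
    have h1 : ∑ x ∈ Finset.Icc p.1.2 ℓ, eps p.1.1 x - ∑ x ∈ Finset.Icc p.1.2 ℓ, eps p.1.2 x
        = -1 := by
      simp only [sum_Icc_eps, Finset.mem_Icc]
      split_ifs <;> omega
    rw [h1]
    linarith
  linarith

theorem finite_support_gg {ℓ : ℕ} {Φ : Finset (ℕ × ℕ)} (hΦ : Φ ⊆ DeltaPlus ℓ) (γ : ℕ → ℤ) :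
    (Function.support fun α => gg ℓ (rootWeight Φ γ α)).Finite := by
  refine (Set.finite_Iic
    (fun p : {p // p ∈ Φ} => (∑ x ∈ Finset.Icc p.1.2 ℓ, (γ x + ℓ)).toNat)).subset ?_
  intro α hα p
  have := le_of_gg_ne_zero hΦ hα p
  simp only
  omega

theorem katalan_zero_insert {ℓ : ℕ} {Φ : Finset (ℕ × ℕ)} {p : ℕ × ℕ} (hp : p ∉ Φ)
    (hΦ : insert p Φ ⊆ DeltaPlus ℓ) (γ : ℕ → ℤ) :
    katalan ℓ Φ 0 γ = katalan ℓ (insert p Φ) 0 γ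
      - katalan ℓ (insert p Φ) 0 (γ + eps p.1 - eps p.2) := by
  set P : {q // q ∈ insert p Φ} := ⟨p, Finset.mem_insert_self p Φ⟩ with hP
  set up : ({q // q ∈ insert p Φ} → ℕ) → ({q // q ∈ insert p Φ} → ℕ) :=
    fun α => α + Pi.single P 1 with hup
  set ext : ({q // q ∈ Φ} → ℕ) → ({q // q ∈ insert p Φ} → ℕ) :=
    fun α q => if h : q.1 ∈ Φ then α ⟨q.1, h⟩ else 0 with hext
  have upInj : Function.Injective up := fun α β h => add_right_cancel h
  have extInj : Function.Injective ext := fun α β h => by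
    funext q
    have := congrFun h ⟨q.1, Finset.mem_insert_of_mem q.2⟩
    simpa [hext, q.2] using this
  have upRange : Set.range up = (Set.range ext)ᶜ := by
    ext α
    have hr : α ∈ Set.range ext ↔ α P = 0 := by
      constructor
      · rintro ⟨β, rfl⟩
        simp [hext, hP, hp]
      · intro h0
        refine ⟨fun q => α ⟨q.1, Finset.mem_insert_of_mem q.2⟩, ?_⟩
        funext q
        by_cases h : q.1 ∈ Φ
        · simp [hext, h]
        · have : q = P := Subtype.ext ((Finset.mem_insert.1 q.2).resolve_right h)
          subst this
          simp [hext, h0]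
    rw [Set.mem_compl_iff, hr]
    constructor
    · rintro ⟨β, rfl⟩
      simp [hup]
    · intro h
      refine ⟨α - Pi.single P 1, ?_⟩
      funext q
      by_cases hq : q = P
      · subst hq
        simp [hup]
        omega
      · simp [hup, hq]
  have hupw : ∀ α, rootWeight (insert p Φ) (γ + eps p.1 - eps p.2) α =
      rootWeight (insert p Φ) γ (up α) := fun α => by
    funext x
    have : ∑ q ∈ (insert p Φ).attach, ((Pi.single P 1 : _ → ℕ) q : ℤ) *
        (eps q.1.1 x - eps q.1.2 x) = eps p.1 x - eps p.2 x := by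
      rw [Finset.sum_eq_single P]
      · simp [hP]
      · intro q _ hq
        simp [hq]
      · exact fun h => absurd (Finset.mem_attach _ _) h
    simp only [rootWeight, hup, Pi.add_apply, Pi.sub_apply, Nat.cast_add, add_mul,
      Finset.sum_add_distrib, this]
    ring
  have hextw : ∀ α, rootWeight Φ γ α = rootWeight (insert p Φ) γ (ext α) := fun α => by
    funext x
    simp only [rootWeight]
    congr 1
    rw [Finset.attach_insert, Finset.sum_insert]
    · rw [Finset.sum_image]
      · simp [hext, hp]
      · rintro ⟨a, _⟩ _ ⟨b, _⟩ _ h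
        simpa using h
    · simp [hp]
  simp only [katalan_zero, hupw, hextw]
  rw [← finsum_mem_range (f := fun α => gg ℓ (rootWeight (insert p Φ) γ α)) upInj,
    ← finsum_mem_range (f := fun α => gg ℓ (rootWeight (insert p Φ) γ α)) extInj, upRange,
    eq_sub_iff_add_eq]
  rw [← finsum_mem_univ (fun α => gg ℓ (rootWeight (insert p Φ) γ α)),
    ← Set.union_compl_self (Set.range ext)]
  exact (finsum_mem_union' disjoint_compl_right ((finite_support_gg hΦ γ).subset
    Set.inter_subset_right) ((finite_support_gg hΦ γ).subset Set.inter_subset_right)).symm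

theorem katalan_insert {ℓ : ℕ} {Φ : Finset (ℕ × ℕ)} {p : ℕ × ℕ} (hp : p ∉ Φ)
    (hΦ : insert p Φ ⊆ DeltaPlus ℓ) (M : Multiset ℕ) (γ : ℕ → ℤ) :
    katalan ℓ Φ M γ = katalan ℓ (insert p Φ) M γ
      - katalan ℓ (insert p Φ) M (γ + eps p.1 - eps p.2) := by
  induction M using Multiset.induction_on generalizing γ with
  | empty => exact katalan_zero_insert hp hΦ γ
  | cons m M ih =>
    have e : γ - eps m + eps p.1 - eps p.2 = γ + eps p.1 - eps p.2 - eps m := by abel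
    rw [katalan_cons, katalan_cons, katalan_cons, ih, ih, e]
    abel

theorem eps_swap (y i x : ℕ) :
    eps (Equiv.swap y (y + 1) i) x = eps i (Equiv.swap y (y + 1) x) := by
  simp only [eps]
  congr 1
  rw [eq_iff_iff, ← Equiv.swap_apply_eq_iff]

theorem dotSwap_sub_eps (y m : ℕ) (γ : ℕ → ℤ) :
    dotSwap y (γ - eps m) = dotSwap y γ - eps (Equiv.swap y (y + 1) m) := by
  funext x
  simp only [dotSwap, Pi.sub_apply, eps_swap]
  ring

theorem katalan_zero_dotSwap {ℓ y : ℕ} {Φ : Finset (ℕ × ℕ)} (hΦ : Φ ⊆ DeltaPlus ℓ) (hy : 1 ≤ y)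
    (hyℓ : y < ℓ)
    (hsym : ∀ i j, (i, j) ∈ Φ ↔ (Equiv.swap y (y + 1) i, Equiv.swap y (y + 1) j) ∈ Φ)
    (γ : ℕ → ℤ) :
    katalan ℓ Φ 0 (dotSwap y γ) - katalan ℓ Φ 0 (dotSwap y γ - eps (y + 1)) =
      -(katalan ℓ Φ 0 γ - katalan ℓ Φ 0 (γ - eps (y + 1))) := by
  set σ := Equiv.swap y (y + 1)
  set e : {p // p ∈ Φ} ≃ {p // p ∈ Φ} :=
    (σ.prodCongr σ).subtypeEquiv fun p => hsym p.1 p.2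
  have hsub : ∀ (δ : ℕ → ℤ) α, rootWeight Φ (δ - eps (y + 1)) α =
      fun x => rootWeight Φ δ α x - eps (y + 1) x := fun δ α => by
    funext x
    simp only [rootWeight, Pi.sub_apply]
    ring
  have hdot : ∀ α : {p // p ∈ Φ} → ℕ, rootWeight Φ (dotSwap y γ) (α ∘ e.symm) =
      dotSwap y (rootWeight Φ γ α) := fun α => by
    funext x
    have hsum : ∑ p ∈ Φ.attach, ((α ∘ e.symm) p : ℤ) * (eps p.1.1 x - eps p.1.2 x) =
        ∑ p ∈ Φ.attach, (α p : ℤ) * (eps p.1.1 (σ x) - eps p.1.2 (σ x)) := by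
      simp only [← Finset.univ_eq_attach]
      rw [← e.sum_comp]
      refine Finset.sum_congr rfl fun p _ => ?_
      rw [← eps_swap, ← eps_swap]
      simp only [Function.comp_apply, Equiv.symm_apply_apply]
      rfl
    simp only [rootWeight, dotSwap, hsum, σ]
    ring
  have hfin : ∀ δ : ℕ → ℤ, katalan ℓ Φ 0 δ - katalan ℓ Φ 0 (δ - eps (y + 1)) =
      ∑ᶠ α, (gg ℓ (rootWeight Φ δ α) - gg ℓ (rootWeight Φ (δ - eps (y + 1)) α)) := fun δ => by
    rw [katalan_zero, katalan_zero,
      finsum_sub_distrib (finite_support_gg hΦ _) (finite_support_gg hΦ _)]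
  rw [hfin, hfin, ← finsum_neg_distrib,
    ← finsum_comp_equiv (Equiv.arrowCongr e (Equiv.refl ℕ))]
  refine finsum_congr fun α => ?_
  have : (Equiv.arrowCongr e (Equiv.refl ℕ)) α = α ∘ e.symm := rfl
  rw [this, hsub, hsub, hdot, gg_dotSwap hy hyℓ]

theorem katalan_dotSwap {ℓ y : ℕ} {Φ : Finset (ℕ × ℕ)} (hΦ : Φ ⊆ DeltaPlus ℓ) (hy : 1 ≤ y)
    (hyℓ : y < ℓ)
    (hsym : ∀ i j, (i, j) ∈ Φ ↔ (Equiv.swap y (y + 1) i, Equiv.swap y (y + 1) j) ∈ Φ)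
    (M : Multiset ℕ) (γ : ℕ → ℤ) :
    katalan ℓ Φ ((y + 1) ::ₘ M.map (Equiv.swap y (y + 1))) (dotSwap y γ) =
      -katalan ℓ Φ ((y + 1) ::ₘ M) γ := by
  induction M using Multiset.induction_on generalizing γ with
  | empty => simpa only [Multiset.map_zero, katalan_cons] using katalan_zero_dotSwap hΦ hy hyℓ hsym γ
  | cons m M ih =>
    rw [Multiset.map_cons, Multiset.cons_swap, katalan_cons, ← dotSwap_sub_eps, ih, ih,
      Multiset.cons_swap, katalan_cons (m := m)]
    abel

/-- A Katalan function vanishes when its root set, its weight and, up to one extra `y + 1`, its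
multiset are invariant under exchanging `y` and `y + 1`. -/
theorem katalan_eq_zero_of_symm {ℓ y : ℕ} {Φ : Finset (ℕ × ℕ)} (hΦ : Φ ⊆ DeltaPlus ℓ)
    (hy : 1 ≤ y) (hyℓ : y < ℓ) (hrow : ∀ j, (y, j) ∈ Φ ↔ (y + 1, j) ∈ Φ)
    (hcol : ∀ i, (i, y) ∈ Φ ↔ (i, y + 1) ∈ Φ) {M : Multiset ℕ}
    (hM : M.count (y + 1) = M.count y + 1) {γ : ℕ → ℤ} (hγ : γ y + 1 = γ (y + 1)) :
    katalan ℓ Φ M γ = 0 := by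
  obtain ⟨N, rfl⟩ := Multiset.exists_cons_of_mem
    (Multiset.count_pos.1 (by omega : 0 < M.count (y + 1)))
  have hN : N.map (Equiv.swap y (y + 1)) = N := by
    ext x
    conv_lhs => rw [← Equiv.swap_apply_self y (y + 1) x]
    simp at hM
    rw [Multiset.count_map_eq_count' _ _ (Equiv.injective _)]
    rcases eq_or_ne x y with rfl | h1
    · simp [hM]
    · rcases eq_or_ne x (y + 1) with rfl | h2
      · simp [hM]
      · rw [Equiv.swap_apply_of_ne_of_ne h1 h2]
  have hδ : dotSwap y γ = γ := by
    funext x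
    rcases eq_or_ne x y with rfl | h1
    · simp [dotSwap, eps]
      omega
    · rcases eq_or_ne x (y + 1) with rfl | h2
      · simp [dotSwap, eps]
        omega
      · simp [dotSwap, eps, Equiv.swap_apply_of_ne_of_ne h1 h2, h1, h2]
  have hone : ∀ i j, (i, j) ∈ Φ ↔ (Equiv.swap y (y + 1) i, j) ∈ Φ := fun i j => by
    rcases eq_or_ne i y with rfl | h1
    · simp [hrow]
    · rcases eq_or_ne i (y + 1) with rfl | h2
      · simp [hrow]
      · rw [Equiv.swap_apply_of_ne_of_ne h1 h2]
  have htwo : ∀ i j, (i, j) ∈ Φ ↔ (i, Equiv.swap y (y + 1) j) ∈ Φ := fun i j => by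
    rcases eq_or_ne j y with rfl | h1
    · simp [hcol]
    · rcases eq_or_ne j (y + 1) with rfl | h2
      · simp [hcol]
      · rw [Equiv.swap_apply_of_ne_of_ne h1 h2]
  have := katalan_dotSwap hΦ hy hyℓ (fun i j => (hone i j).trans (htwo _ j)) N γ
  rw [hN, hδ] at this
  have h2 : (2 : ℚ) • katalan ℓ Φ ((y + 1) ::ₘ N) γ = 0 := by
    rw [two_smul]
    exact eq_neg_iff_add_eq_zero.1 this
  exact (smul_eq_zero.1 h2).resolve_left two_ne_zero

theorem mem_DeltaPlus {ℓ i j : ℕ} : (i, j) ∈ DeltaPlus ℓ ↔ 1 ≤ i ∧ i < j ∧ j ≤ ℓ := by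
  simp only [DeltaPlus, Finset.mem_filter, Finset.mem_product, Finset.mem_Icc]
  omega

theorem mem_DeltaK {k ℓ i j : ℕ} {lam : ℕ → ℤ} : (i, j) ∈ DeltaK k ℓ lam ↔
    1 ≤ i ∧ i < j ∧ j ≤ ℓ ∧ (k : ℤ) - lam i + i < j := by
  simp only [DeltaK, Finset.mem_filter, mem_DeltaPlus, and_assoc]

theorem IsKBounded.antitone {k ℓ : ℕ} {lam : ℕ → ℤ} (hlam : IsKBounded k ℓ lam) {i j : ℕ}
    (hi : 1 ≤ i) (hij : i ≤ j) (hj : j ≤ ℓ) : lam j ≤ lam i := by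
  induction j, hij using Nat.le_induction with
  | base => exact le_rfl
  | succ n hn ih => exact (hlam.2.1 n (by omega) (by omega)).trans (ih (by omega))

theorem IsKBounded.le {k ℓ : ℕ} {lam : ℕ → ℤ} (hlam : IsKBounded k ℓ lam) {i : ℕ}
    (hi : 1 ≤ i) (hj : i ≤ ℓ) : lam i ≤ k :=
  (hlam.antitone le_rfl hi hj).trans hlam.1

theorem le_botL_of_lt {k ℓ i : ℕ} {lam : ℕ → ℤ} (hi : 1 ≤ i) (hiℓ : i < ℓ)
    (h : (k : ℤ) - lam i + i < ℓ) : i ≤ botL k ℓ lam :=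
  Finset.le_sup (f := Prod.fst) (mem_DeltaK.2 ⟨hi, hiℓ, le_rfl, h⟩)

theorem lt_of_le_botL {k ℓ i : ℕ} {lam : ℕ → ℤ} (hlam : IsKBounded k ℓ lam) (hi : 1 ≤ i)
    (hib : i ≤ botL k ℓ lam) : i < ℓ ∧ (k : ℤ) - lam i + i < ℓ := by
  have hne : (DeltaK k ℓ lam).Nonempty := by
    rw [Finset.nonempty_iff_ne_empty]
    intro h
    simp [botL, botIdeal, h] at hib
    omega
  obtain ⟨⟨x, j⟩, hp, hx⟩ := Finset.exists_mem_eq_sup _ hne Prod.fst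
  have hx' : botL k ℓ lam = x := hx
  obtain ⟨h1, h2, h3, h4⟩ := mem_DeltaK.1 hp
  have := hlam.antitone hi (hx' ▸ hib) (by omega)
  omega

theorem isRemovable_DeltaK_iff {k ℓ x j : ℕ} {lam : ℕ → ℤ} (hlam : IsKBounded k ℓ lam)
    (hx : 1 ≤ x) (hxb : x ≤ botL k ℓ lam) :
    IsRemovable ℓ (DeltaK k ℓ lam) (x, j) ↔ (j : ℤ) = k - lam x + x + 1 := by
  obtain ⟨hxℓ, hxk⟩ := lt_of_le_botL hlam hx hxb
  have hle := hlam.le hx hxℓ.le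
  constructor
  · rintro ⟨hmem, -, hideal⟩
    obtain ⟨h1, h2, h3, h4⟩ := mem_DeltaK.1 hmem
    by_contra hne
    have hmem' : (x, j - 1) ∈ (DeltaK k ℓ lam).erase (x, j) := by
      refine Finset.mem_erase.2 ⟨?_, mem_DeltaK.2 (by omega)⟩
      simp only [ne_eq, Prod.mk.injEq, not_and]
      omega
    exact Finset.notMem_erase _ _
      (hideal x (j - 1) x j hmem' (mem_DeltaPlus.2 (by omega)) le_rfl (by omega))
  · intro hj
    refine ⟨mem_DeltaK.2 (by omega), ?_, ?_⟩
    · exact (Finset.erase_subset _ _).trans (Finset.filter_subset _ _)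
    · intro a b c d hab hcd hca hbd
      rw [Finset.mem_erase, mem_DeltaK] at hab
      rw [mem_DeltaPlus] at hcd
      have hac := hlam.antitone (i := c) (j := a) (by omega) hca (by omega)
      refine Finset.mem_erase.2 ⟨?_, mem_DeltaK.2 (by omega)⟩
      rintro ⟨⟩
      exact hab.1 (Prod.ext (by simp only; omega) (by simp only; omega))

theorem downL_eq {k ℓ x : ℕ} {lam : ℕ → ℤ} (hlam : IsKBounded k ℓ lam) (hx : 1 ≤ x)
    (hxb : x ≤ botL k ℓ lam) : (downL k ℓ lam x : ℤ) = k - lam x + x + 1 := by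
  obtain ⟨hxℓ, hxk⟩ := lt_of_le_botL hlam hx hxb
  have hle := hlam.le hx hxℓ.le
  obtain ⟨j, hj⟩ : ∃ j : ℕ, (j : ℤ) = k - lam x + x + 1 :=
    ⟨(k - lam x + x + 1 : ℤ).toNat, by omega⟩
  have : (DeltaK k ℓ lam).filter (fun p => p.1 = x ∧ IsRemovable ℓ (DeltaK k ℓ lam) p) =
      {(x, j)} := by
    ext ⟨c, d⟩
    simp only [Finset.mem_filter, Finset.mem_singleton, Prod.mk.injEq]
    constructor
    · rintro ⟨-, rfl, h⟩
      rw [isRemovable_DeltaK_iff hlam hx hxb] at h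
      omega
    · rintro ⟨rfl, rfl⟩
      have := (isRemovable_DeltaK_iff hlam hx hxb).2 hj
      exact ⟨this.1, rfl, this⟩
  rw [downL, down, this]
  simpa using hj

theorem downL_eq_zero {k ℓ x : ℕ} {lam : ℕ → ℤ} (hx : x = 0 ∨ botL k ℓ lam < x) :
    downL k ℓ lam x = 0 := by
  have : (DeltaK k ℓ lam).filter (fun p => p.1 = x ∧ IsRemovable ℓ (DeltaK k ℓ lam) p) = ∅ := by
    refine Finset.filter_eq_empty_iff.2 ?_
    rintro ⟨c, d⟩ hp ⟨rfl, -⟩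
    have h1 := (mem_DeltaK.1 hp).1
    have h2 : c ≤ botL k ℓ lam := Finset.le_sup (f := Prod.fst) hp
    simp only at hx
    omega
  rw [downL, down, this]
  rfl

theorem count_Lmul_DeltaK {k ℓ n : ℕ} {lam : ℕ → ℤ} {y : ℕ}
    (h : ∀ i, (i, y) ∈ DeltaK k ℓ lam ↔ 1 ≤ i ∧ i ≤ n) :
    (Lmul (DeltaK k ℓ lam)).count y = n := by
  rw [Lmul, Multiset.count_map]
  have : (DeltaK k ℓ lam).filter (fun p => y = p.2) = (Finset.Icc 1 n).image (fun i => (i, y)) := by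
    ext ⟨i, j⟩
    simp only [Finset.mem_filter, Finset.mem_image, Finset.mem_Icc, Prod.mk.injEq]
    constructor
    · rintro ⟨hm, rfl⟩
      exact ⟨i, (h i).1 hm, rfl, rfl⟩
    · rintro ⟨i, hi, rfl, rfl⟩
      exact ⟨(h i).2 hi, rfl⟩
  have hc := congrArg Finset.card this
  rw [Finset.card_image_of_injective _ (fun a b h => (Prod.mk.inj h).1), Nat.card_Icc] at hc
  simpa [Finset.card] using hc

theorem downL_lt_downL {k ℓ x x' : ℕ} {lam : ℕ → ℤ} (hlam : IsKBounded k ℓ lam) (hx : 1 ≤ x)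
    (hxx' : x < x') (hxb : x' ≤ botL k ℓ lam) : downL k ℓ lam x < downL k ℓ lam x' := by
  have h1 := downL_eq hlam hx (by omega)
  have h2 := downL_eq hlam (by omega) hxb
  have := hlam.antitone hx hxx'.le (lt_of_le_botL hlam (by omega) hxb).1.le
  omega

theorem count_map_downL {k ℓ z x : ℕ} {lam : ℕ → ℤ} (hlam : IsKBounded k ℓ lam) (hz : 1 ≤ z)
    (hx : x ∈ Finset.Icc z (botL k ℓ lam)) :
    ((Finset.Icc z (botL k ℓ lam)).val.map (downL k ℓ lam)).count (downL k ℓ lam x) = 1 := by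
  rw [Multiset.count_map_eq_count _ _ _ _ hx]
  · exact Multiset.count_eq_one_of_mem (Finset.nodup _) hx
  · intro a ha b hb hab
    have ha' := Finset.mem_Icc.1 ha
    have hb' := Finset.mem_Icc.1 hb
    by_contra hne
    rcases lt_or_gt_of_ne hne with h | h
    · have := downL_lt_downL hlam (by omega) h hb'.2
      omega
    · have := downL_lt_downL hlam (by omega) h ha'.2
      omega

theorem mem_column_downL {k ℓ x : ℕ} {lam : ℕ → ℤ} (hlam : IsKBounded k ℓ lam) (hx : 1 ≤ x)
    (hxb : x ≤ botL k ℓ lam) (i : ℕ) :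
    (i, downL k ℓ lam x) ∈ DeltaK k ℓ lam ↔ 1 ≤ i ∧ i ≤ x := by
  have h1 := downL_eq hlam hx hxb
  obtain ⟨h2, h3⟩ := lt_of_le_botL hlam hx hxb
  have hle := hlam.le hx h2.le
  rw [mem_DeltaK]
  constructor
  · rintro ⟨hi1, hi2, hi3, hi4⟩
    refine ⟨hi1, ?_⟩
    by_contra! hlt
    have := hlam.antitone hx hlt.le (by omega)
    omega
  · rintro ⟨hi1, hi2⟩
    have := hlam.antitone hi1 hi2 h2.le
    omega

theorem mem_column_downL_succ_of_lt {k ℓ x : ℕ} {lam : ℕ → ℤ} (hlam : IsKBounded k ℓ lam)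
    (hx : 1 ≤ x) (hxb : x ≤ botL k ℓ lam) (hd : downL k ℓ lam x < ℓ)
    (hlt : lam (x + 1) < lam x) (i : ℕ) :
    (i, downL k ℓ lam x + 1) ∈ DeltaK k ℓ lam ↔ 1 ≤ i ∧ i ≤ x := by
  have h1 := downL_eq hlam hx hxb
  obtain ⟨h2, h3⟩ := lt_of_le_botL hlam hx hxb
  have hle := hlam.le hx h2.le
  rw [mem_DeltaK]
  constructor
  · rintro ⟨hi1, hi2, hi3, hi4⟩
    refine ⟨hi1, ?_⟩
    by_contra! hlt
    have := hlam.antitone (i := x + 1) (j := i) (by omega) hlt (by omega)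
    omega
  · rintro ⟨hi1, hi2⟩
    have := hlam.antitone hi1 hi2 h2.le
    omega

theorem downL_succ_of_eq {k ℓ x : ℕ} {lam : ℕ → ℤ} (hlam : IsKBounded k ℓ lam)
    (hx : 1 ≤ x) (hxb : x ≤ botL k ℓ lam) (hd : downL k ℓ lam x < ℓ)
    (heq : lam (x + 1) = lam x) :
    x + 1 ≤ botL k ℓ lam ∧ downL k ℓ lam (x + 1) = downL k ℓ lam x + 1 := by
  have h1 := downL_eq hlam hx hxb
  have hle := hlam.le hx (lt_of_le_botL hlam hx hxb).1.le
  have hb : x + 1 ≤ botL k ℓ lam := le_botL_of_lt (by omega) (by omega) (by push_cast; omega)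
  have h2 := downL_eq hlam (by omega) hb
  exact ⟨hb, by push_cast at h2; omega⟩

theorem count_Mz_downL_succ {k ℓ z x : ℕ} {lam : ℕ → ℤ} (hlam : IsKBounded k ℓ lam)
    (hz : 1 ≤ z) (hzx : z ≤ x) (hxb : x ≤ botL k ℓ lam) (hd : downL k ℓ lam x < ℓ) :
    (Mz k ℓ lam z).count (downL k ℓ lam x + 1) = (Mz k ℓ lam z).count (downL k ℓ lam x) + 1 := by
  have hx : 1 ≤ x := hz.trans hzx
  rw [Mz, Multiset.count_sub, Multiset.count_sub,
    count_map_downL hlam hz (Finset.mem_Icc.2 ⟨hzx, hxb⟩),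
    count_Lmul_DeltaK (mem_column_downL hlam hx hxb)]
  rcases (hlam.2.1 x hx (lt_of_le_botL hlam hx hxb).1).lt_or_eq with hlt | heq
  · rw [count_Lmul_DeltaK (mem_column_downL_succ_of_lt hlam hx hxb hd hlt),
      Multiset.count_eq_zero_of_notMem]
    · omega
    · intro hmem
      obtain ⟨w, hw, hwe⟩ := Multiset.mem_map.1 hmem
      have hw' : z ≤ w ∧ w ≤ botL k ℓ lam := Finset.mem_Icc.1 hw
      have e1 := downL_eq hlam hx hxb
      have e2 := downL_eq hlam (by omega) hw'.2
      have hwℓ := (lt_of_le_botL hlam (by omega) hw'.2).1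
      rcases le_or_gt w x with h | h
      · have := hlam.antitone (by omega) h (lt_of_le_botL hlam hx hxb).1.le
        omega
      · have := hlam.antitone (i := x + 1) (j := w) (by omega) h (by omega)
        omega
  · obtain ⟨hb, he⟩ := downL_succ_of_eq hlam hx hxb hd heq
    rw [← he, count_map_downL hlam hz (Finset.mem_Icc.2 ⟨by omega, hb⟩),
      count_Lmul_DeltaK (mem_column_downL hlam (by omega) hb)]
    omega

theorem iterate_downL_bounds {k ℓ z : ℕ} {lam : ℕ → ℤ} (hlam : IsKBounded k ℓ lam) {n : ℕ}
    (hy : 1 ≤ (downL k ℓ lam)^[n + 1] z) :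
    1 ≤ (downL k ℓ lam)^[n] z ∧ (downL k ℓ lam)^[n] z ≤ botL k ℓ lam ∧
      (downL k ℓ lam)^[n] z < (downL k ℓ lam)^[n + 1] z := by
  rw [Function.iterate_succ_apply'] at hy ⊢
  set x := (downL k ℓ lam)^[n] z
  by_cases h : x = 0 ∨ botL k ℓ lam < x
  · rw [downL_eq_zero h] at hy
    omega
  · have h1 : 1 ≤ x := by omega
    have h2 : x ≤ botL k ℓ lam := by omega
    have := downL_eq hlam h1 h2
    have := hlam.le h1 (lt_of_le_botL hlam h1 h2).1.le
    omega

theorem le_iterate_downL {k ℓ z : ℕ} {lam : ℕ → ℤ} (hlam : IsKBounded k ℓ lam) {n : ℕ}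
    (hy : 1 ≤ (downL k ℓ lam)^[n] z) : z ≤ (downL k ℓ lam)^[n] z := by
  induction n with
  | zero => exact le_rfl
  | succ n ih =>
    have := iterate_downL_bounds hlam hy
    exact (ih this.1).trans this.2.2.le

/-- Vanishing along a bounce path that starts in a row `z` with `λ_z > λ_{z+1}`: the root set `Φ`
agrees with `Δ^k(λ)` above row `y` and has equal rows `y` and `y + 1`. -/
theorem katalan_eq_zero_of_path {k ℓ z : ℕ} {lam : ℕ → ℤ} (hlam : IsKBounded k ℓ lam)
    (hz : 1 ≤ z) (hstrict : lam (z + 1) < lam z) (n : ℕ) {y : ℕ}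
    (hy : (downL k ℓ lam)^[n + 1] z = y) (hy1 : 1 ≤ y) (hyb : y ≤ botL k ℓ lam)
    {Φ : Finset (ℕ × ℕ)} (hΦ : Φ ⊆ DeltaPlus ℓ)
    (hrows : ∀ i j, i < y → ((i, j) ∈ Φ ↔ (i, j) ∈ DeltaK k ℓ lam))
    (hwall : ∀ j, (y, j) ∈ Φ ↔ (y + 1, j) ∈ Φ) {γ : ℕ → ℤ} (hγ : ∀ i < y, γ i = lam i)
    (hγy : γ y + 1 = γ (y + 1)) : katalan ℓ Φ (Mz k ℓ lam z) γ = 0 := by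
  induction n using Nat.strong_induction_on generalizing y Φ γ with | _ n ih => ?_
  have hyb' := lt_of_le_botL hlam hy1 hyb
  obtain ⟨hx1, hxb, hxy⟩ := iterate_downL_bounds (z := z) hlam (n := n) (by omega)
  have hzx := le_iterate_downL hlam hx1
  have hxd := Function.iterate_succ_apply' (downL k ℓ lam) n z
  set x := (downL k ℓ lam)^[n] z with hxn
  rw [hy] at hxd hxy
  have hltk : ∀ i, z < i → i ≤ y → lam i < k := fun i hi hiy => by
    have h1 := hlam.le hz (by omega)
    have h2 := hlam.antitone (i := z + 1) (j := i) (by omega) hi (by omega)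
    omega
  have hcols : ∀ i j, j ≤ y + 1 → ((i, j) ∈ Φ ↔ (i, j) ∈ DeltaK k ℓ lam) := fun i j hj => by
    rcases lt_or_ge i y with hi | hi
    · exact hrows i j hi
    · refine iff_of_false (fun hm => ?_) (fun hm => ?_)
      · have h1 := mem_DeltaPlus.1 (hΦ hm)
        obtain ⟨rfl, rfl⟩ : i = y ∧ j = y + 1 := by omega
        have h2 := mem_DeltaPlus.1 (hΦ ((hwall _).1 hm))
        omega
      · have h1 := mem_DeltaK.1 hm
        obtain ⟨rfl, rfl⟩ : i = y ∧ j = y + 1 := by omega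
        have h2 := hltk i (by omega) le_rfl
        omega
  have hcount := count_Mz_downL_succ hlam hz hzx hxb (by omega)
  have hcol := mem_column_downL hlam hx1 hxb
  rw [← hxd] at hcount hcol
  rcases (hlam.2.1 x hx1 (by omega)).lt_or_eq with hlt | heq
  · refine katalan_eq_zero_of_symm hΦ hy1 hyb'.1 hwall (fun i => ?_) hcount hγy
    have h := mem_column_downL_succ_of_lt hlam hx1 hxb (by omega) hlt i
    rw [← hxd] at h
    rw [hcols _ _ (by omega), hcols _ _ le_rfl, hcol, h]
  · obtain ⟨hxb1, hxd1⟩ := downL_succ_of_eq hlam hx1 hxb (by omega) heq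
    have hcol1 := mem_column_downL hlam (by omega) hxb1
    rw [hxd1, ← hxd] at hcol1
    have hzx' : z < x := hzx.lt_of_ne fun h => by rw [← h] at heq; omega
    have hdx := downL_eq hlam hx1 hxb
    have hdx1 := downL_eq hlam (by omega) hxb1
    have hxk := hltk x hzx' (by omega)
    have hxy1 : x + 1 < y := by omega
    have hp : (x + 1, y) ∉ Φ := by
      rw [hcols _ _ (by omega), hcol]
      omega
    have hΦ' : insert (x + 1, y) Φ ⊆ DeltaPlus ℓ :=
      Finset.insert_subset (mem_DeltaPlus.2 (by omega)) hΦ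
    rw [katalan_insert hp hΦ', katalan_eq_zero_of_symm (y := y) hΦ' hy1 hyb'.1 _ _ hcount hγy]
    · obtain ⟨m, rfl⟩ : ∃ m, n = m + 1 := Nat.exists_eq_succ_of_ne_zero fun h => by
        subst h
        exact hzx'.ne hxn.symm
      rw [ih m (Nat.lt_succ_self m) hxn.symm hx1 hxb hΦ', sub_zero]
      · intro i j hi
        rw [Finset.mem_insert, hrows _ _ (by omega)]
        grind
      · intro j
        rw [Finset.mem_insert, Finset.mem_insert, hrows _ _ hxy, hrows _ _ hxy1, mem_DeltaK,
          mem_DeltaK]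
        grind
      · intro i hi
        simp [eps, hγ i (by omega), show i ≠ x + 1 by omega, show i ≠ y by omega]
      · simp [eps, hγ x hxy, hγ (x + 1) hxy1, heq, show x ≠ y by omega,
          show x + 1 ≠ y by omega]
    · intro j
      rw [Finset.mem_insert, Finset.mem_insert, hwall]
      grind
    · intro i
      rw [Finset.mem_insert, Finset.mem_insert, hcols _ _ (by omega), hcols _ _ le_rfl, hcol,
        hcol1]
      grind

/-- lowering at `d = down_λ^a(z) ∈ [bot_λ]` when `γ = λ − ε_d ∉ P_ℓ^k`. -/
theorem statement8 (k ℓ : ℕ) (hℓ : 1 ≤ ℓ) (lam : ℕ → ℤ) (hlam : IsKBounded k ℓ lam)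
    (z : ℕ) (hz : z ∈ Finset.Icc 1 (botL k ℓ lam - 1)) (a : ℕ) (ha : 1 ≤ a)
    (hd : (downL k ℓ lam)^[a] z ∈ Finset.Icc 1 (botL k ℓ lam))
    (hγ : ¬ IsKBounded k ℓ (lam - eps ((downL k ℓ lam)^[a] z)))
    (hstrict : lam (z + 1) < lam z) :
    katalan ℓ (DeltaK k ℓ lam) (Mz k ℓ lam z) (lam - eps ((downL k ℓ lam)^[a] z)) =
      katalan ℓ (DeltaK k ℓ lam) (Mz k ℓ lam z) (lam - eps ((downL k ℓ lam)^[a + 1] z)) := by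
  obtain ⟨hz1, hzb⟩ := Finset.mem_Icc.1 hz
  obtain ⟨n, rfl⟩ : ∃ n, a = n + 1 := ⟨a - 1, by omega⟩
  rw [Function.iterate_succ_apply' _ (n + 1)]
  obtain ⟨hd1, hdb⟩ := Finset.mem_Icc.1 hd
  have hx := iterate_downL_bounds hlam hd1
  have hzd := (le_iterate_downL hlam hx.1).trans_lt hx.2.2
  generalize hdef : (downL k ℓ lam)^[n + 1] z = d at *
  obtain ⟨hdℓ, hdk⟩ := lt_of_le_botL hlam hd1 hdb
  have he := downL_eq hlam hd1 hdb
  generalize downL k ℓ lam d = e at *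
  have hle := hlam.le hd1 hdℓ.le
  have hlt : lam d < k := by
    have h1 := hlam.le hz1 (by omega)
    have h2 := hlam.antitone (i := z + 1) (j := d) (by omega) hzd (by omega)
    omega
  have heq : lam (d + 1) = lam d := by
    by_contra hne
    have hdd := (hlam.2.1 d hd1 hdℓ).lt_of_ne hne
    refine hγ ⟨?_, fun i hi hiℓ => ?_, ?_⟩
    · have := hlam.1
      simp only [Pi.sub_apply, eps]
      split_ifs <;> omega
    · have := hlam.2.1 i hi hiℓ
      simp only [Pi.sub_apply, eps]
      rcases eq_or_ne i d with rfl | hid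
      · simp
        omega
      · split_ifs <;> omega
    · have := hlam.2.2
      simp [eps, hdℓ.ne']
      omega
  have hmem : (d, e) ∈ DeltaK k ℓ lam := mem_DeltaK.2 (by omega)
  have hins := Finset.insert_erase hmem
  have hsub : DeltaK k ℓ lam ⊆ DeltaPlus ℓ := Finset.filter_subset _ _
  have hexp := katalan_insert (Finset.notMem_erase (d, e) (DeltaK k ℓ lam))
    (hins.symm ▸ hsub) (Mz k ℓ lam z) (lam - eps d)
  rw [hins, katalan_eq_zero_of_path hlam hz1 hstrict n hdef hd1 hdb
    ((Finset.erase_subset _ _).trans hsub)] at hexp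
  · have hw : lam - eps d + eps d - eps e = lam - eps e := by abel
    rw [← hw]
    exact sub_eq_zero.1 hexp.symm
  · intro i j hi
    rw [Finset.mem_erase, and_iff_right]
    simp only [ne_eq, Prod.mk.injEq, not_and]
    omega
  · intro j
    rw [Finset.mem_erase, Finset.mem_erase, mem_DeltaK, mem_DeltaK]
    grind
  · intro i hi
    simp [eps, hi.ne]
  · simp [eps, heq]

end
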